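/- Let p_t(z) = (4πt)^{-1/2} exp(−z²/(4t)) and G_t(x,y) = Σ_{n ∈ ℤ} [ p_t(x − y − 2n) − p_t(x + y − 2n) ] for t > 0, x, y ∈ [0,1]. Then for every T > 0 and every x ∈ (0,1) there exists a constant c_x > 0 such that for all 0 ≤ t' < t ≤ T: c_x · (t − t')^{1/2} ≤ ∫_{t'}^{t} ∫₀¹ G_{t−s}(x,y)² dy ds. Moreover, for every α ∈ (0, 1/2), inf_{α ≤ x ≤ 1−α} c_x > 0. -/

import Mathlib

open MeasureTheory Real
open scoped Real

/-- The free heat kernel `p_t(z) = (4πt)^{-1/2} exp(-z²/(4t))` on `ℝ`. -/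
noncomputable def heatKernel (t z : ℝ) : ℝ :=
  (Real.sqrt (4 * π * t))⁻¹ * Real.exp (-z ^ 2 / (4 * t))

/-- The Dirichlet heat kernel on `[0,1]` given by the method of images. -/
noncomputable def dirichletGreen (t x y : ℝ) : ℝ :=
  ∑' n : ℤ, (heatKernel t (x - y - 2 * (n : ℝ)) - heatKernel t (x + y - 2 * (n : ℝ)))

lemma hk_nonneg (t z : ℝ) : 0 ≤ heatKernel t z := by
  unfold heatKernel; positivity

lemma hk_mono {t z w : ℝ} (ht : 0 < t) (h : z ^ 2 ≤ w ^ 2) : heatKernel t w ≤ heatKernel t z := by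
  unfold heatKernel
  gcongr

lemma hk_summable {t : ℝ} (ht : 0 < t) (c : ℝ) :
    Summable (fun n : ℤ => heatKernel t (c - 2 * (n : ℝ))) := by
  have h := HurwitzKernelBounds.summable_f_int 0 (-c / 2) (t := 1 / (π * t)) (by positivity)
  have h2 := h.mul_left ((Real.sqrt (4 * π * t))⁻¹)
  refine h2.congr fun n => ?_
  unfold heatKernel HurwitzKernelBounds.f_int
  have hp := Real.pi_pos
  rw [pow_zero, one_mul]
  congr 2
  field_simp
  ring

lemma int_split {f : ℤ → ℝ} (hf : Summable f) :
    Summable (fun n : ℕ => f (n + 1)) ∧ Summable (fun n : ℕ => f (-(n + 1))) ∧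
    ∑' n : ℤ, f n = f 0 + ∑' n : ℕ, f (n + 1) + ∑' n : ℕ, f (-(n + 1)) := by
  have h1 : Summable (fun n : ℕ => f n) := hf.comp_injective Nat.cast_injective
  have h2 : Summable (fun n : ℕ => f (-(n + 1))) :=
    hf.comp_injective (i := fun n : ℕ => (-(n + 1) : ℤ)) (fun a b h => by
      simp only at h; omega)
  refine ⟨?_, h2, ?_⟩
  · have := (summable_nat_add_iff 1).2 h1
    simpa using this
  · rw [tsum_of_nat_of_neg_add_one h1 h2, h1.tsum_eq_zero_add]
    simp

lemma green_bounds {t x y : ℝ} (ht : 0 < t) (hx : x ∈ Set.Icc (0:ℝ) 1) (hy : y ∈ Set.Icc (0:ℝ) 1) :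
    heatKernel t (x - y) - heatKernel t (x + y) - heatKernel t (x + y - 2) ≤ dirichletGreen t x y ∧
    dirichletGreen t x y ≤ heatKernel t (x - y) := by
  obtain ⟨hx0, hx1⟩ := hx
  obtain ⟨hy0, hy1⟩ := hy
  have ha := hk_summable ht (x - y)
  have hb := hk_summable ht (x + y)
  have hG : dirichletGreen t x y = _ := ha.tsum_sub hb
  obtain ⟨a1, a2, a3⟩ := int_split ha
  obtain ⟨b1, b2, b3⟩ := int_split hb
  rw [hG, a3, b3]
  push_cast at a1 a2 b1 b2 ⊢
  have b1' := (summable_nat_add_iff 1).2 b1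
  have e1 := b1.tsum_eq_zero_add
  have b2' : Summable (fun n : ℕ => heatKernel t (x + y - 2 * (-(n : ℝ)))) := by
    refine (summable_nat_add_iff 1).1 ?_
    simpa using b2
  have e2 := b2'.tsum_eq_zero_add
  push_cast at b1' e1 e2
  have l1 := b1'.tsum_le_tsum (fun n => hk_mono ht (by
    have : (0:ℝ) ≤ n := n.cast_nonneg
    nlinarith)) a1
  have l2 := b2.tsum_le_tsum (fun n : ℕ => hk_mono (z := x - y - 2 * (-((n:ℝ) + 1))) ht (by
    have : (0:ℝ) ≤ n := n.cast_nonneg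
    nlinarith)) a2
  have u1 := a1.tsum_le_tsum (fun n => hk_mono ht (by
    have : (0:ℝ) ≤ n := n.cast_nonneg
    nlinarith)) b2'
  have u2 := a2.tsum_le_tsum (fun n => hk_mono ht (by
    have : (0:ℝ) ≤ n := n.cast_nonneg
    nlinarith)) b1
  simp only [neg_zero, mul_zero, sub_zero, zero_add, mul_one] at *
  constructor <;> linarith

lemma green_abs {t x y : ℝ} (ht : 0 < t) (hx : x ∈ Set.Icc (0:ℝ) 1) (hy : y ∈ Set.Icc (0:ℝ) 1) :
    |dirichletGreen t x y| ≤ 2 * heatKernel t (x - y) := by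
  obtain ⟨h1, h2⟩ := green_bounds ht hx hy
  obtain ⟨hx0, hx1⟩ := hx
  obtain ⟨hy0, hy1⟩ := hy
  have := hk_nonneg t (x - y)
  have := hk_mono (z := x - y) (w := x + y) ht (by nlinarith)
  have := hk_mono (z := x - y) (w := x + y - 2) ht (by nlinarith)
  rw [abs_le]; constructor <;> linarith

lemma green_sq_le {t x y : ℝ} (ht : 0 < t) (hx : x ∈ Set.Icc (0:ℝ) 1) (hy : y ∈ Set.Icc (0:ℝ) 1) :
    dirichletGreen t x y ^ 2 ≤ (π * t)⁻¹ * Real.exp (-(2 * t)⁻¹ * (y - x) ^ 2) := by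
  have h := green_abs ht hx hy
  have h2 : dirichletGreen t x y ^ 2 ≤ (2 * heatKernel t (x - y)) ^ 2 := by
    rw [← sq_abs]; gcongr
  refine h2.trans (le_of_eq ?_)
  unfold heatKernel
  have hp := Real.pi_pos
  rw [mul_pow, mul_pow, inv_pow, Real.sq_sqrt (by positivity), ← Real.exp_nat_mul]
  rw [← mul_assoc]
  congr 1
  · field_simp; norm_num
  · congr 1; push_cast; field_simp; ring

lemma green_meas (x : ℝ) : Measurable (fun p : ℝ × ℝ => dirichletGreen p.1 x p.2) := by
  have hm : ∀ n : ℤ, Measurable (fun p : ℝ × ℝ =>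
      heatKernel p.1 (x - p.2 - 2 * (n : ℝ)) - heatKernel p.1 (x + p.2 - 2 * (n : ℝ))) := by
    intro n
    unfold heatKernel
    fun_prop
  refine measurable_of_tendsto_metrizable' (Filter.atTop : Filter (Finset ℤ))
    (f := fun (s : Finset ℤ) (p : ℝ × ℝ) => ∑ n ∈ s, (heatKernel p.1 (x - p.2 - 2 * (n : ℝ)) -
      heatKernel p.1 (x + p.2 - 2 * (n : ℝ)))) ?_ ?_
  · intro s
    exact Finset.measurable_sum s (fun n _ => hm n)
  · rw [tendsto_pi_nhds]
    intro p
    have : Summable (fun n : ℤ => heatKernel p.1 (x - p.2 - 2 * (n : ℝ)) -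
        heatKernel p.1 (x + p.2 - 2 * (n : ℝ))) := by
      rcases lt_or_ge 0 p.1 with h | h
      · exact (hk_summable h _).sub (hk_summable h _)
      · have h0 : ∀ z, heatKernel p.1 z = 0 := by
          intro z
          unfold heatKernel
          rw [Real.sqrt_eq_zero_of_nonpos]
          · simp
          · have := Real.pi_pos
            nlinarith
        simp [h0, summable_zero]
    exact this.hasSum

lemma gauss_int {t : ℝ} (ht : 0 < t) (x : ℝ) :
    Integrable (fun y : ℝ => (π * t)⁻¹ * Real.exp (-(2 * t)⁻¹ * (y - x) ^ 2)) :=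
  ((integrable_exp_neg_mul_sq (b := (2 * t)⁻¹) (by positivity)).comp_sub_right x).const_mul _

lemma green_sq_ii {t x : ℝ} (ht : 0 < t) (hx : x ∈ Set.Icc (0:ℝ) 1) :
    IntervalIntegrable (fun y => dirichletGreen t x y ^ 2) volume 0 1 := by
  rw [intervalIntegrable_iff_integrableOn_Ioc_of_le zero_le_one]
  refine Integrable.mono' (gauss_int ht x).integrableOn ?_ ?_
  · have : Measurable (fun y => dirichletGreen t x y) :=
      (green_meas x).comp (measurable_const.prodMk measurable_id)
    exact (this.pow_const 2).aestronglyMeasurable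
  · filter_upwards [ae_restrict_mem measurableSet_Ioc] with y hy
    rw [Real.norm_of_nonneg (sq_nonneg _)]
    exact green_sq_le ht hx (Set.Ioc_subset_Icc_self hy)

lemma F_nonneg (t x : ℝ) : 0 ≤ ∫ y in (0:ℝ)..1, dirichletGreen t x y ^ 2 :=
  intervalIntegral.integral_nonneg zero_le_one (fun _ _ => sq_nonneg _)

lemma F_upper {t x : ℝ} (ht : 0 < t) (hx : x ∈ Set.Icc (0:ℝ) 1) :
    ∫ y in (0:ℝ)..1, dirichletGreen t x y ^ 2 ≤ (π⁻¹ * √(2 * π)) * t ^ (-(1/2) : ℝ) := by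
  have h1 : ∫ y in (0:ℝ)..1, dirichletGreen t x y ^ 2 ≤
      ∫ y in (0:ℝ)..1, (π * t)⁻¹ * Real.exp (-(2 * t)⁻¹ * (y - x) ^ 2) :=
    intervalIntegral.integral_mono_on zero_le_one (green_sq_ii ht hx)
      (gauss_int ht x).intervalIntegrable (fun y hy => green_sq_le ht hx hy)
  have h2 : ∫ y in (0:ℝ)..1, (π * t)⁻¹ * Real.exp (-(2 * t)⁻¹ * (y - x) ^ 2) ≤
      ∫ y, (π * t)⁻¹ * Real.exp (-(2 * t)⁻¹ * (y - x) ^ 2) := by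
    rw [intervalIntegral.integral_of_le zero_le_one]
    refine setIntegral_le_integral (gauss_int ht x) (Filter.Eventually.of_forall fun y => ?_)
    have := Real.pi_pos
    simp only [Pi.zero_apply]
    positivity
  refine (h1.trans h2).trans (le_of_eq ?_)
  rw [integral_const_mul,
    integral_sub_right_eq_self (fun y => Real.exp (-(2 * t)⁻¹ * y ^ 2)) x, integral_gaussian]
  have hp := Real.pi_pos
  have e : π / (2 * t)⁻¹ = (2 * π) * t := by field_simp
  rw [e, Real.sqrt_mul (by positivity), Real.rpow_neg ht.le, ← Real.sqrt_eq_rpow]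
  have hs : √t ≠ 0 := (Real.sqrt_pos.2 ht).ne'
  field_simp
  rw [Real.sq_sqrt ht.le]

lemma F_ii {x : ℝ} (hx : x ∈ Set.Icc (0:ℝ) 1) {h : ℝ} (hh : 0 ≤ h) :
    IntervalIntegrable (fun t => ∫ y in (0:ℝ)..1, dirichletGreen t x y ^ 2) volume 0 h := by
  have hi : IntervalIntegrable (fun t : ℝ => (π⁻¹ * √(2 * π)) * t ^ (-(1/2) : ℝ)) volume 0 h :=
    (intervalIntegral.intervalIntegrable_rpow' (by norm_num)).const_mul _
  rw [intervalIntegrable_iff_integrableOn_Ioc_of_le hh] at hi ⊢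
  refine Integrable.mono' hi ?_ ?_
  · simp only [intervalIntegral.integral_of_le zero_le_one]
    have hm : StronglyMeasurable (fun p : ℝ × ℝ => dirichletGreen p.1 x p.2 ^ 2) :=
      ((green_meas x).pow_const 2).stronglyMeasurable
    exact (hm.integral_prod_right' (ν := volume.restrict (Set.Ioc (0:ℝ) 1))).aestronglyMeasurable
  · filter_upwards [ae_restrict_mem measurableSet_Ioc] with t ht
    rw [Real.norm_of_nonneg (F_nonneg _ _)]
    exact F_upper ht.1 hx

lemma hk_quarter {t z w a : ℝ} (ht : 0 < t) (hta : 4 * t ≤ a ^ 2) (h : z ^ 2 + 2 * a ^ 2 ≤ w ^ 2) :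
    heatKernel t w ≤ heatKernel t z / 4 := by
  have h2 : -w ^ 2 / (4 * t) ≤ -z ^ 2 / (4 * t) + (-2) := by
    rw [div_add' _ _ _ (by positivity)]
    gcongr
    linarith
  have h3 : Real.exp (-2) ≤ 1 / 4 := by
    have : Real.exp (-2) = (Real.exp 1 ^ 2)⁻¹ := by
      rw [← Real.exp_nat_mul, ← Real.exp_neg]; norm_num
    rw [this, one_div]
    have := Real.exp_one_gt_d9
    apply inv_anti₀ <;> nlinarith
  unfold heatKernel
  have h4 := Real.exp_le_exp.2 h2
  rw [Real.exp_add] at h4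
  have h5 : Real.exp (-w ^ 2 / (4 * t)) ≤ Real.exp (-z ^ 2 / (4 * t)) / 4 := by
    have := Real.exp_pos (-z ^ 2 / (4 * t))
    nlinarith
  have h6 : 0 ≤ (√(4 * π * t))⁻¹ := by positivity
  rw [mul_div_assoc]
  gcongr

lemma green_lower {t x y a : ℝ} (ht : 0 < t) (ha : 0 < a) (hta : 4 * t ≤ a ^ 2)
    (hx : x ∈ Set.Icc a (1 - a)) (hy : y ∈ Set.Icc (x - √t) (x + √t)) :
    Real.exp (-(1/2)) / (16 * π) / t ≤ dirichletGreen t x y ^ 2 := by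
  have hs : √t ≤ a / 2 := by
    rw [Real.sqrt_le_left (by positivity)]; linarith
  obtain ⟨hx0, hx1⟩ := hx
  obtain ⟨hy0, hy1⟩ := hy
  obtain ⟨hg, -⟩ := green_bounds (x := x) (y := y) ht ⟨by linarith, by linarith⟩ ⟨by linarith, by linarith⟩
  have q1 := hk_quarter (z := x - y) (w := x + y) ht hta (by nlinarith)
  have q2 := hk_quarter (z := x - y) (w := x + y - 2) ht hta (by nlinarith)
  have hxy : (x - y) ^ 2 ≤ (√t) ^ 2 := sq_le_sq' (by linarith) (by linarith)
  have hm := hk_mono ht hxy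
  have hg2 : heatKernel t (√t) / 2 ≤ dirichletGreen t x y := by linarith
  have h0 := hk_nonneg t (√t)
  have : (heatKernel t (√t) / 2) ^ 2 ≤ dirichletGreen t x y ^ 2 := by gcongr
  refine le_trans (le_of_eq ?_) this
  unfold heatKernel
  have hp := Real.pi_pos
  rw [div_pow, mul_pow, inv_pow, Real.sq_sqrt (by positivity), ← Real.exp_nat_mul,
    Real.sq_sqrt ht.le]
  have e : ((2:ℕ):ℝ) * (-t / (4 * t)) = -(1/2) := by push_cast; field_simp; norm_num
  rw [e]
  field_simp
  norm_num

lemma F_lower {t x a : ℝ} (ht : 0 < t) (ha : 0 < a) (hta : 4 * t ≤ a ^ 2)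
    (hx : x ∈ Set.Icc a (1 - a)) :
    Real.exp (-(1/2)) / (8 * π) / √t ≤ ∫ y in (0:ℝ)..1, dirichletGreen t x y ^ 2 := by
  have hs : √t ≤ a / 2 := by
    rw [Real.sqrt_le_left (by positivity)]; linarith
  have hs0 := Real.sqrt_pos.2 ht
  have hx' : x ∈ Set.Icc (0:ℝ) 1 := ⟨by linarith [hx.1], by linarith [hx.2]⟩
  have h0 : (0:ℝ) ≤ x - √t := by linarith [hx.1]
  have h1 : x + √t ≤ 1 := by linarith [hx.2]
  have hii := green_sq_ii ht hx'
  have A : ∫ y in (x - √t)..(x + √t), dirichletGreen t x y ^ 2 ≤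
      ∫ y in (0:ℝ)..1, dirichletGreen t x y ^ 2 :=
    intervalIntegral.integral_mono_interval h0 (by linarith) h1
      (Filter.Eventually.of_forall fun y => sq_nonneg _) hii
  have B : ∫ y in (x - √t)..(x + √t), Real.exp (-(1/2)) / (16 * π) / t ≤
      ∫ y in (x - √t)..(x + √t), dirichletGreen t x y ^ 2 := by
    refine intervalIntegral.integral_mono_on (by linarith) (by simp) ?_
      (fun y hy => green_lower ht ha hta hx hy)
    refine hii.mono_set ?_
    rw [Set.uIcc_of_le (by linarith), Set.uIcc_of_le zero_le_one]
    exact Set.Icc_subset_Icc h0 h1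
  refine le_trans (le_of_eq ?_) (B.trans A)
  rw [intervalIntegral.integral_const, smul_eq_mul]
  have hp := Real.pi_pos
  field_simp
  have := Real.sq_sqrt ht.le
  linear_combination (-16) * this

theorem dirichletGreen_sq_integral_lower (T : ℝ) (hT : 0 < T) :
    ∃ c : ℝ → ℝ,
      (∀ x ∈ Set.Ioo (0 : ℝ) 1, 0 < c x ∧
        ∀ t' t : ℝ, 0 ≤ t' → t' < t → t ≤ T →
          c x * Real.sqrt (t - t')
            ≤ ∫ s in t'..t, ∫ y in (0 : ℝ)..1, (dirichletGreen (t - s) x y) ^ 2) ∧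
      ∀ α ∈ Set.Ioo (0 : ℝ) (1 / 2), 0 < sInf (c '' Set.Icc α (1 - α)) := by
  have hp := Real.pi_pos
  set k : ℝ := Real.exp (-(1/2)) / (8 * π) with hk
  have hk0 : 0 < k := by positivity
  let d : ℝ → ℝ := fun a => k * √(min (a ^ 2 / 4) T / T)
  have hd : ∀ a, 0 < a → 0 < d a := fun a ha => by
    have : 0 < min (a ^ 2 / 4) T := lt_min (by positivity) hT
    positivity
  refine ⟨fun x => d (min x (1 - x)), ?_, ?_⟩
  · rintro x ⟨hx0, hx1⟩
    have ha : 0 < min x (1 - x) := lt_min hx0 (by linarith)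
    refine ⟨hd _ ha, ?_⟩
    intro t' t ht' htt htT
    rw [intervalIntegral.integral_comp_sub_left
      (fun r => ∫ y in (0 : ℝ)..1, (dirichletGreen r x y) ^ 2) t, sub_self]
    set a := min x (1 - x) with hadef
    have hxa : x ∈ Set.Icc a (1 - a) :=
      ⟨min_le_left _ _, by linarith [min_le_right x (1 - x)]⟩
    have hx' : x ∈ Set.Icc (0:ℝ) 1 := ⟨hx0.le, hx1.le⟩
    set h := t - t' with hh
    have hpos : 0 < h := by linarith
    have hhT : h ≤ T := by linarith
    set δ := min (a ^ 2 / 4) T with hδ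
    have hδ0 : 0 < δ := lt_min (by positivity) hT
    set e := δ / T * h with he
    have he0 : 0 < e := by positivity
    have heh : e ≤ h := by
      have : δ / T ≤ 1 := (div_le_one hT).2 (min_le_right _ _)
      nlinarith
    have heδ : e ≤ δ := by
      rw [he, div_mul_eq_mul_div, div_le_iff₀ hT]
      gcongr
    have hea : 4 * e ≤ a ^ 2 := by linarith [min_le_left (a ^ 2 / 4) T]
    have hii := F_ii hx' hpos.le
    have A := intervalIntegral.integral_mono_interval (μ := volume) le_rfl he0.le heh
      (Filter.Eventually.of_forall fun r => F_nonneg r x) hii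
    have B : ∫ r in (0:ℝ)..e, k / √e ≤
        ∫ r in (0:ℝ)..e, ∫ y in (0 : ℝ)..1, (dirichletGreen r x y) ^ 2 := by
      refine intervalIntegral.integral_mono_on_of_le_Ioo he0.le (by simp) (F_ii hx' he0.le) ?_
      intro r hr
      refine le_trans ?_ (F_lower hr.1 ha (by linarith [hr.2]) hxa)
      have := Real.sqrt_pos.2 hr.1
      have := Real.sqrt_le_sqrt hr.2.le
      rw [← hk]
      gcongr
    refine le_trans (le_of_eq ?_) (B.trans A)
    rw [intervalIntegral.integral_const, smul_eq_mul, sub_zero]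
    have hse := Real.sqrt_pos.2 he0
    have e1 : d a * √h = k * √e := by
      simp only [d]
      rw [he, Real.sqrt_mul (by positivity), mul_assoc]
    rw [e1]
    field_simp
    rw [Real.sq_sqrt he0.le]
  · rintro α ⟨h0, h1⟩
    refine lt_of_lt_of_le (hd α h0) (le_csInf ?_ ?_)
    · exact (Set.nonempty_Icc.2 (by linarith)).image _
    · rintro _ ⟨x, ⟨hx0, hx1⟩, rfl⟩
      have : α ≤ min x (1 - x) := le_min hx0 (by linarith)
      simp only [d]
      gcongr
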